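/- Let 0 < n ≤ N be integers, let Σ ⊆ ℝ^N be a Borel set, and let R > 1. Then F[Σ \ B_R] ≤ R^n · e^{−(R²−1)/4} · F[Σ/R], where B_R is the open ball of radius R centered at the origin and Σ/R := { x/R : x ∈ Σ }. In particular, F[Σ \ B_R] ≤ R^n · e^{−(R²−1)/4} · λ[Σ]. -/

import Mathlib

open MeasureTheory Set
open scoped ENNReal

/-- The Gaussian area `F[S] = (4π)^{−n/2} ∫_S e^{−|x|²/4} dH^n(x)` of a subset of
`ℝ^N`, valued in `ℝ≥0∞`. -/
noncomputable def gaussianArea (N n : ℕ) (S : Set (EuclideanSpace ℝ (Fin N))) :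
    ℝ≥0∞ :=
  ENNReal.ofReal ((4 * Real.pi) ^ (-(n : ℝ) / 2)) *
    ∫⁻ x in S, ENNReal.ofReal (Real.exp (-‖x‖ ^ 2 / 4)) ∂(μH[(n : ℝ)])

/-- The entropy `λ[S] = sup_{x₀ ∈ ℝ^N, t₀ > 0} F[(S − x₀)/t₀]`. -/
noncomputable def entropy (N n : ℕ) (S : Set (EuclideanSpace ℝ (Fin N))) : ℝ≥0∞ :=
  ⨆ (x₀ : EuclideanSpace ℝ (Fin N)) (t₀ : ℝ) (_ : 0 < t₀),
    gaussianArea N n ((fun x => t₀⁻¹ • (x - x₀)) '' S)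

open scoped Pointwise in
/-- Scaling of the Hausdorff measure, in terms of integrals. -/
theorem lintegral_scale_aux (N n : ℕ) (A : Set (EuclideanSpace ℝ (Fin N)))
    (R : ℝ) (hR : 0 < R) (g : EuclideanSpace ℝ (Fin N) → ℝ≥0∞) :
    ∫⁻ x in A, g (R⁻¹ • x) ∂(μH[(n : ℝ)]) =
      ENNReal.ofReal (R ^ n) * ∫⁻ x in (fun x => R⁻¹ • x) '' A, g x ∂(μH[(n : ℝ)]) := by
  have hR' : R⁻¹ ≠ 0 := inv_ne_zero hR.ne'
  have he : MeasurableEmbedding (fun x : EuclideanSpace ℝ (Fin N) => R⁻¹ • x) :=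
    (Homeomorph.smulOfNeZero R⁻¹ hR').measurableEmbedding
  have hinj : Function.Injective (fun x : EuclideanSpace ℝ (Fin N) => R⁻¹ • x) := he.injective
  have hmap : Measure.map (fun x : EuclideanSpace ℝ (Fin N) => R⁻¹ • x) μH[(n : ℝ)] =
      ENNReal.ofReal (R ^ n) • (μH[(n : ℝ)] : Measure (EuclideanSpace ℝ (Fin N))) := by
    ext s hs
    rw [he.map_apply, Set.preimage_smul_inv₀ hR.ne',
      Measure.hausdorffMeasure_smul₀ (Nat.cast_nonneg n) hR.ne', Measure.smul_apply,
      NNReal.rpow_natCast, ENNReal.smul_def, smul_eq_mul, smul_eq_mul]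
    congr 1
    rw [ENNReal.ofReal_pow hR.le, ENNReal.coe_pow, ← enorm_eq_nnnorm, Real.enorm_of_nonneg hR.le]
  have h := he.lintegral_map (μ := (μH[(n : ℝ)]).restrict A) g
  rw [← h, ← Set.preimage_image_eq A hinj, ← he.restrict_map, hmap,
    Measure.restrict_smul, lintegral_smul_measure, Set.preimage_image_eq A hinj, smul_eq_mul]

/-- non-concentration of Gaussian area near infinity: for a Borel set
`Σ ⊆ ℝ^N` and `R > 1`, `F[Σ \ B_R] ≤ Rⁿ e^{−(R²−1)/4} F[Σ/R]`, and in particular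
`F[Σ \ B_R] ≤ Rⁿ e^{−(R²−1)/4} λ[Σ]`. -/
theorem gaussianArea_nonconcentration (N n : ℕ) (hn : 0 < n) (hnN : n ≤ N)
    (A : Set (EuclideanSpace ℝ (Fin N))) (hA : MeasurableSet A)
    (R : ℝ) (hR : 1 < R) :
    gaussianArea N n (A \ Metric.ball 0 R)
        ≤ ENNReal.ofReal (R ^ n * Real.exp (-(R ^ 2 - 1) / 4)) *
            gaussianArea N n ((fun x => R⁻¹ • x) '' A) ∧
    gaussianArea N n (A \ Metric.ball 0 R)
        ≤ ENNReal.ofReal (R ^ n * Real.exp (-(R ^ 2 - 1) / 4)) *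
            entropy N n A := by
  have key : gaussianArea N n (A \ Metric.ball 0 R)
        ≤ ENNReal.ofReal (R ^ n * Real.exp (-(R ^ 2 - 1) / 4)) *
            gaussianArea N n ((fun x => R⁻¹ • x) '' A) := by
    have hR0 : 0 < R := by linarith
    unfold gaussianArea
    rw [mul_left_comm]
    gcongr
    rw [mul_comm (R ^ n), ENNReal.ofReal_mul (Real.exp_pos _).le, mul_assoc,
      ← lintegral_scale_aux N n A R hR0 (fun x => ENNReal.ofReal (Real.exp (-‖x‖ ^ 2 / 4))),
      ← lintegral_const_mul' _ _ ENNReal.ofReal_ne_top]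
    refine le_trans ?_ (lintegral_mono_set (Set.diff_subset (t := Metric.ball 0 R)))
    refine setLIntegral_mono' (hA.diff Metric.isOpen_ball.measurableSet) ?_
    intro x hx
    have hx2 : R ≤ ‖x‖ := by simpa using hx.2
    rw [← ENNReal.ofReal_mul (Real.exp_pos _).le, ← Real.exp_add]
    apply ENNReal.ofReal_le_ofReal
    apply Real.exp_le_exp.mpr
    rw [norm_smul, norm_inv, Real.norm_of_nonneg hR0.le]
    obtain ⟨y, hy⟩ : ∃ y, y = R⁻¹ * ‖x‖ := ⟨_, rfl⟩
    have hxy : ‖x‖ = R * y := by rw [hy]; field_simp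
    have hy1 : 1 ≤ y := by
      by_contra hc
      push Not at hc
      nlinarith
    rw [← hy, hxy]
    have h1 : 0 ≤ (R ^ 2 - 1) * (y ^ 2 - 1) := mul_nonneg (by nlinarith) (by nlinarith)
    nlinarith
  refine ⟨key, key.trans ?_⟩
  gcongr
  unfold entropy
  refine le_trans ?_ (le_iSup_of_le 0 (le_iSup_of_le R (le_iSup_of_le (by linarith) le_rfl)))
  simp
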